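/- Suppose every approximate proximal point used by inexact FedExProx is an ε₂-relative approximation, i.e., ‖x̃_{i,k+1} − prox_{γf_i}(x_k)‖² ≤ ε₂ · ‖x_k − prox_{γf_i}(x_k)‖² for all i and k, where 0 ≤ ε₂ < μ²/(4L_max²), and set the extrapolation parameter to α = (1/(γL_γ)) · (μ − 2√ε₂ L_max)/(μ + 4√ε₂ L_max + 4ε₂ L_max). Then for every K ≥ 0, Δ_K ≤ (1 − (μ/(4L_γ(1 + γL_max))) · S(ε₂))^K · (L_γ(1 + γL_max)/μ) · Δ_0, where S(ε₂) = (μ − 2√ε₂ L_max)(1 − 2√ε₂ L_max/μ)/(μ + 4√ε₂ L_max + 4ε₂ L_max); moreover 0 < S(ε₂) ≤ 1. -/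

import Mathlib

section SmoothConvex

variable {E : Type*} [NormedAddCommGroup E] [InnerProductSpace ℝ E]

theorem StrongConvexOn.quadratic_growth {f : E → ℝ} {m : ℝ} {x : E}
    (hf : StrongConvexOn Set.univ m f) (hx : ∀ y, f x ≤ f y) (y : E) :
    m / 2 * ‖y - x‖ ^ 2 ≤ f y - f x := by
  by_contra! h
  set c := m / 2 * ‖y - x‖ ^ 2 with hc
  set X := f y - f x with hX
  have hX0 : 0 ≤ X := sub_nonneg.2 (hx y)
  have hc0 : 0 < c := hX0.trans_lt h
  set a := (c - X) / (2 * c) with ha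
  have ha0 : 0 < a := by have : 0 < c - X := by linarith
                         positivity
  have hac : a * c = (c - X) / 2 := by rw [ha]; field_simp
  have ha1 : a ≤ 1 := by rw [ha, div_le_one (by positivity)]; linarith
  have h₁ := hf.2 (Set.mem_univ y) (Set.mem_univ x) ha0.le (sub_nonneg.2 ha1) (by ring)
  have h₂ := hx (a • y + (1 - a) • x)
  simp only [smul_eq_mul] at h₁
  rw [← hc] at h₁
  have h₃ : a * ((1 - a) * c) ≤ a * X := by rw [hX]; linarith
  have h₄ := le_of_mul_le_mul_left h₃ ha0
  linarith

theorem sq_norm_mean_le {n : ℕ} (hn : 1 ≤ n) (v : Fin n → E) :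
    ‖(1 / (n : ℝ)) • ∑ i, v i‖ ^ 2 ≤ (1 / (n : ℝ)) * ∑ i, ‖v i‖ ^ 2 := by
  have hn0 : (0 : ℝ) < n := by exact_mod_cast hn
  have h₁ : ‖∑ i, v i‖ ^ 2 ≤ (∑ i, ‖v i‖) ^ 2 := by gcongr; exact norm_sum_le _ _
  have h₂ := sq_sum_le_card_mul_sum_sq (s := Finset.univ) (f := fun i => ‖v i‖)
  rw [Finset.card_univ, Fintype.card_fin] at h₂
  rw [norm_smul, mul_pow, Real.norm_eq_abs, sq_abs]
  calc (1 / (n : ℝ)) ^ 2 * ‖∑ i, v i‖ ^ 2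
      ≤ (1 / (n : ℝ)) ^ 2 * (n * ∑ i, ‖v i‖ ^ 2) := by gcongr; exact h₁.trans h₂
    _ = _ := by field_simp

/-- A convex-type gradient inequality together with quadratic growth gives a
Polyak–Łojasiewicz inequality. -/
theorem polyak_lojasiewicz_of_quadratic_growth {B μ D : ℝ} {g v : E}
    (hD : 0 ≤ D) (hμ : 0 < μ) (hB : 0 < B) (hin : D ≤ inner ℝ g v)
    (hQ : μ / 2 * ‖v‖ ^ 2 ≤ B * D) : μ * D ≤ 2 * B * ‖g‖ ^ 2 := by
  rcases hD.eq_or_lt with rfl | hD0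
  · rw [mul_zero]; positivity
  refine le_of_mul_le_mul_left ?_ hD0
  have h₁ : D ^ 2 ≤ (‖g‖ * ‖v‖) ^ 2 := by gcongr; exact hin.trans (real_inner_le_norm g v)
  have h₂ := mul_le_mul_of_nonneg_left h₁ hμ.le
  have h₃ := mul_le_mul_of_nonneg_left hQ (sq_nonneg ‖g‖)
  nlinarith

variable [CompleteSpace E]

theorem HasGradientAt.hasDerivAt_line {f : E → ℝ} {g : E} {x v : E} {t : ℝ}
    (h : HasGradientAt f g (x + t • v)) :
    HasDerivAt (fun s : ℝ => f (x + s • v)) (inner ℝ g v) t := by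
  have hl : HasDerivAt (fun s : ℝ => x + s • v) v t := by
    simpa using ((hasDerivAt_id t).smul_const v).const_add x
  have hc := h.hasFDerivAt.comp_hasDerivAt t hl
  rw [InnerProductSpace.toDual_apply_apply] at hc
  exact hc

/-- The descent lemma for functions with Lipschitz gradient. -/
theorem le_add_inner_add_sq_of_lipschitz_gradient {f : E → ℝ} {f' : E → E} {L : ℝ}
    (hf : ∀ x, HasGradientAt f (f' x) x) (hL : ∀ x y, ‖f' x - f' y‖ ≤ L * ‖x - y‖) (x v : E) :
    f (x + v) ≤ f x + inner ℝ (f' x) v + L / 2 * ‖v‖ ^ 2 := by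
  set φ : ℝ → ℝ := fun t => f (x + t • v) - t * inner ℝ (f' x) v - L / 2 * ‖v‖ ^ 2 * t ^ 2
  have hφ (t : ℝ) : HasDerivAt φ
      (inner ℝ (f' (x + t • v)) v - inner ℝ (f' x) v - L / 2 * ‖v‖ ^ 2 * (2 * t)) t := by
    have h₁ := (hf (x + t • v)).hasDerivAt_line
    have h₂ := (hasDerivAt_id t).mul_const (inner ℝ (f' x) v)
    have h₃ := (hasDerivAt_pow 2 t).const_mul (L / 2 * ‖v‖ ^ 2)
    refine ((h₁.sub h₂).sub h₃).congr_deriv ?_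
    simp
  have hanti : AntitoneOn φ (Set.Icc 0 1) := by
    refine antitoneOn_of_deriv_nonpos (convex_Icc 0 1)
      (fun t _ => (hφ t).continuousAt.continuousWithinAt)
      (fun t _ => (hφ t).differentiableAt.differentiableWithinAt) fun t ht => ?_
    rw [interior_Icc] at ht
    rw [(hφ t).deriv, ← inner_sub_left]
    have h₁ := real_inner_le_norm (f' (x + t • v) - f' x) v
    have h₂ := hL (x + t • v) x
    rw [add_sub_cancel_left, norm_smul, Real.norm_of_nonneg ht.1.le] at h₂
    nlinarith [mul_le_mul_of_nonneg_right h₂ (norm_nonneg v)]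
  have := hanti (Set.left_mem_Icc.2 zero_le_one) (Set.right_mem_Icc.2 zero_le_one) zero_le_one
  simp only [φ, zero_smul, one_smul, add_zero] at this
  linarith

/-- A convex function lies above its tangents. -/
theorem ConvexOn.add_inner_le_of_hasGradientAt {f : E → ℝ} {g x : E}
    (hf : ConvexOn ℝ Set.univ f) (hg : HasGradientAt f g x) (y : E) :
    f x + inner ℝ g (y - x) ≤ f y := by
  have hc : ConvexOn ℝ Set.univ (fun t : ℝ => f (x + t • (y - x))) := by
    have := hf.comp_affineMap (AffineMap.lineMap x y : ℝ →ᵃ[ℝ] E)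
    simpa [Function.comp_def, AffineMap.lineMap_apply, add_comm] using this
  have hd : HasDerivAt (fun t : ℝ => f (x + t • (y - x))) (inner ℝ g (y - x)) 0 :=
    HasGradientAt.hasDerivAt_line (by simpa using hg)
  have := hc.le_slope_of_hasDerivAt (Set.mem_univ 0) (Set.mem_univ 1) one_pos hd
  simp [slope_def_field] at this
  linarith

theorem ConvexOn.le_of_hasGradientAt_zero {f : E → ℝ} {x : E}
    (hf : ConvexOn ℝ Set.univ f) (hg : HasGradientAt f 0 x) (y : E) : f x ≤ f y := by
  simpa using hf.add_inner_le_of_hasGradientAt hg y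

/-- The squared gradient norm of a smooth function is controlled by its suboptimality. -/
theorem sq_norm_gradient_le {f : E → ℝ} {f' : E → E} {L m : ℝ} (hL0 : 0 < L)
    (hf : ∀ x, HasGradientAt f (f' x) x) (hL : ∀ x y, ‖f' x - f' y‖ ≤ L * ‖x - y‖)
    (hm : ∀ x, m ≤ f x) (x : E) : ‖f' x‖ ^ 2 ≤ 2 * L * (f x - m) := by
  have h := le_add_inner_add_sq_of_lipschitz_gradient hf hL x (-(1 / L) • f' x)
  have h' := hm (x + -(1 / L) • f' x)
  rw [inner_smul_right, real_inner_self_eq_norm_sq, norm_smul, mul_pow, Real.norm_eq_abs,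
    sq_abs] at h
  have e : -(1 / L) * ‖f' x‖ ^ 2 + L / 2 * ((-(1 / L)) ^ 2 * ‖f' x‖ ^ 2)
      = -(‖f' x‖ ^ 2 / (2 * L)) := by field_simp; ring
  have h₂ : ‖f' x‖ ^ 2 / (2 * L) ≤ f x - m := by linarith
  rw [div_le_iff₀ (by positivity)] at h₂
  linarith

/-- First-order optimality condition for the proximal subproblem. -/
theorem gradient_eq_of_isMinOn_prox {f : E → ℝ} {g x p : E} {γ : ℝ}
    (hg : HasGradientAt f g p)
    (hp : IsMinOn (fun z => f z + ‖z - x‖ ^ 2 / (2 * γ)) Set.univ p) :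
    g = (1 / γ) • (x - p) := by
  refine ext_inner_right ℝ fun v => ?_
  have h₁ : HasDerivAt (fun t : ℝ => f (p + t • v)) (inner ℝ g v) 0 :=
    HasGradientAt.hasDerivAt_line (by simpa using hg)
  have h₂ : HasDerivAt (fun t : ℝ => p + t • v - x) v 0 := by
    simpa using (((hasDerivAt_id (0 : ℝ)).smul_const v).const_add p).sub_const x
  have h₃ := h₁.add (h₂.norm_sq.div_const (2 * γ))
  have hmin : IsLocalMin
      ((fun t : ℝ => f (p + t • v)) + fun t : ℝ => ‖p + t • v - x‖ ^ 2 / (2 * γ)) 0 :=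
    Filter.Eventually.of_forall fun t => by
      simpa using hp (Set.mem_univ (p + t • v))
  have h₄ := hmin.hasDerivAt_eq_zero h₃
  simp only [zero_smul, add_zero] at h₄
  rw [mul_div_mul_left _ _ two_ne_zero] at h₄
  rw [real_inner_smul_left, ← neg_sub p x, inner_neg_left]
  linear_combination h₄

section Prox

variable {f : E → ℝ} {f' : E → E} {L γ : ℝ} {x p xs : E}

theorem sub_le_mul_moreau_sub (hf : ∀ x, HasGradientAt f (f' x) x)
    (hL : ∀ x y, ‖f' x - f' y‖ ≤ L * ‖x - y‖) (hL0 : 0 < L) (hγ : 0 < γ)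
    (hxs : ∀ y, f xs ≤ f y) (hp : f' p = (1 / γ) • (x - p)) :
    f x - f xs ≤ (1 + γ * L) * (f p + ‖p - x‖ ^ 2 / (2 * γ) - f xs) ∧
      (1 + γ * L) * ‖p - x‖ ^ 2 ≤
        2 * γ ^ 2 * L * (f p + ‖p - x‖ ^ 2 / (2 * γ) - f xs) := by
  have h₁ := sq_norm_gradient_le hL0 hf hL hxs p
  have h₂ := le_add_inner_add_sq_of_lipschitz_gradient hf hL p (x - p)
  rw [add_sub_cancel, hp, real_inner_smul_left, real_inner_self_eq_norm_sq] at h₂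
  rw [hp, norm_smul, mul_pow, Real.norm_eq_abs, sq_abs] at h₁
  rw [norm_sub_rev p x]
  set r := ‖x - p‖ ^ 2
  have h₃ : r ≤ 2 * γ ^ 2 * L * (f p - f xs) := by
    rw [show (1 / γ) ^ 2 * r = r / γ ^ 2 by ring, div_le_iff₀ (by positivity)] at h₁
    linarith
  have h₄ : r / (2 * γ) ≤ γ * L * (f p - f xs) := by
    rw [div_le_iff₀ (by positivity)]; linarith
  have e₁ : 2 * γ ^ 2 * L * (r / (2 * γ)) = γ * L * r := by field_simp
  have e₂ : γ * L * (r / (2 * γ)) = L / 2 * r := by field_simp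
  have e₃ : 1 / γ * r = 2 * (r / (2 * γ)) := by field_simp
  constructor <;> linarith

theorem mul_moreau_sub_le_inner (hf : ConvexOn ℝ Set.univ f) (hg : HasGradientAt f (f' p) p)
    (hγ : 0 < γ) (hp : f' p = (1 / γ) • (x - p)) :
    γ * (f p + ‖p - x‖ ^ 2 / (2 * γ) - f xs) ≤ inner ℝ (x - p) (x - xs) := by
  have h := hf.add_inner_le_of_hasGradientAt hg xs
  rw [hp, real_inner_smul_left] at h
  have e : (inner ℝ (x - p) (x - xs) : ℝ) = ‖x - p‖ ^ 2 - inner ℝ (x - p) (xs - p) := by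
    rw [← real_inner_self_eq_norm_sq, ← inner_sub_right]; congr 1; abel
  have h₂ : γ * (f p - f xs) ≤ - inner ℝ (x - p) (xs - p) := by
    have := mul_le_mul_of_nonneg_left h hγ.le
    rw [mul_add, ← mul_assoc, mul_one_div_cancel hγ.ne', one_mul] at this
    linarith
  have e₂ : γ * (‖p - x‖ ^ 2 / (2 * γ)) = ‖x - p‖ ^ 2 / 2 := by rw [norm_sub_rev]; field_simp
  rw [e]
  nlinarith [sq_nonneg ‖x - p‖]

end Prox

/-- One step of gradient descent with step size `α`, where the scaled gradient `γ • M' x` is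
perturbed by an error `e` controlled by the suboptimality gap. -/
theorem biased_gradient_step {M : E → ℝ} {M' : E → E} {Lγ μ Lm B γ ε α S m : ℝ} {x e : E}
    (hM : ∀ x, HasGradientAt M (M' x) x) (hLip : ∀ x y, ‖M' x - M' y‖ ≤ Lγ * ‖x - y‖)
    (hLγ : 0 < Lγ) (hμ : 0 < μ) (hμL : μ ≤ Lm) (hB : 0 < B) (hγ : 0 < γ) (hε : 0 ≤ ε)
    (hεμ : 2 * √ε * Lm < μ)
    (hα : α = (1 / (γ * Lγ)) * ((μ - 2 * √ε * Lm) / (μ + 4 * √ε * Lm + 4 * ε * Lm)))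
    (hS : S = (μ - 2 * √ε * Lm) * (1 - 2 * √ε * Lm / μ) / (μ + 4 * √ε * Lm + 4 * ε * Lm))
    (hPL : μ * (M x - m) ≤ 2 * B * ‖M' x‖ ^ 2)
    (he : B * ‖e‖ ^ 2 ≤ 2 * ε * γ ^ 2 * Lm * (M x - m)) :
    M (x - α • (γ • M' x - e)) - m ≤ (1 - μ / (4 * Lγ * B) * S) * (M x - m) := by
  have hLm : 0 < Lm := hμ.trans_le hμL
  have hs := Real.sq_sqrt hε
  have hs0 := Real.sqrt_nonneg ε
  set s := √ε
  set G := ‖M' x‖ with hG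
  have hG0 : 0 ≤ G := norm_nonneg _
  set D := μ + 4 * s * Lm + 4 * ε * Lm with hD
  have hD0 : 0 < D := by positivity
  set c := μ - 2 * s * Lm with hc
  have hc0 : 0 < c := by linarith
  have hα0 : 0 < α := by rw [hα]; positivity
  have he₁ : μ * ‖e‖ ^ 2 ≤ 4 * ε * γ ^ 2 * Lm * G ^ 2 := by
    refine le_of_mul_le_mul_left ?_ hB
    have := mul_le_mul_of_nonneg_left hPL (show 0 ≤ 2 * ε * γ ^ 2 * Lm by positivity)
    nlinarith [mul_le_mul_of_nonneg_left he hμ.le]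
  have he₂ : μ * ‖e‖ ≤ 2 * s * γ * Lm * G := by
    refine abs_le_of_sq_le_sq' ?_ (by positivity) |>.2
    have h₁ := mul_le_mul_of_nonneg_left he₁ hμ.le
    have h₂ := mul_le_mul_of_nonneg_left hμL
      (show 0 ≤ 4 * ε * γ ^ 2 * Lm * G ^ 2 by positivity)
    calc (μ * ‖e‖) ^ 2 = μ * (μ * ‖e‖ ^ 2) := by ring
      _ ≤ 4 * ε * γ ^ 2 * Lm * G ^ 2 * Lm := by linarith
      _ = (2 * s * γ * Lm * G) ^ 2 := by rw [← hs]; ring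
  have hdesc := le_add_inner_add_sq_of_lipschitz_gradient hM hLip x (-(α • (γ • M' x - e)))
  rw [← sub_eq_add_neg, inner_neg_right, real_inner_smul_right, inner_sub_right,
    real_inner_smul_right, real_inner_self_eq_norm_sq, norm_neg, norm_smul, mul_pow,
    Real.norm_eq_abs, sq_abs, ← hG] at hdesc
  have hin : μ * inner ℝ (M' x) e ≤ 2 * s * γ * Lm * G ^ 2 := by
    have := mul_le_mul_of_nonneg_left (real_inner_le_norm (M' x) e) hμ.le
    nlinarith [mul_le_mul_of_nonneg_left he₂ hG0]
  have hnorm : μ * ‖γ • M' x - e‖ ^ 2 ≤ γ ^ 2 * G ^ 2 * D := by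
    have h₁ : ‖γ • M' x - e‖ ≤ γ * G + ‖e‖ := by
      have := norm_sub_le (γ • M' x) e
      rwa [norm_smul, Real.norm_of_nonneg hγ.le] at this
    have h₂ : ‖γ • M' x - e‖ ^ 2 ≤ (γ * G + ‖e‖) ^ 2 := by gcongr
    have h₃ := mul_le_mul_of_nonneg_left he₂ (show 0 ≤ 2 * γ * G by positivity)
    have h₄ := mul_le_mul_of_nonneg_left h₂ hμ.le
    rw [hD]
    linarith
  have hαD : α * (γ * Lγ) * D = c := by rw [hα]; field_simp
  have hkey : M (x - α • (γ • M' x - e)) ≤ M x - S / (2 * Lγ) * G ^ 2 := by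
    have h₁ : α * (μ * inner ℝ (M' x) e) ≤ α * (2 * s * γ * Lm * G ^ 2) := by gcongr
    have h₂ : Lγ / 2 * α ^ 2 * (μ * ‖γ • M' x - e‖ ^ 2)
        ≤ Lγ / 2 * α ^ 2 * (γ ^ 2 * G ^ 2 * D) := by gcongr
    have h₃ : Lγ / 2 * α ^ 2 * (γ ^ 2 * G ^ 2 * D) = α * γ * c / 2 * G ^ 2 := by
      rw [← hαD]; ring
    have h₄ : μ * (S / (2 * Lγ)) = α * γ * c / 2 := by
      rw [hα, hS, hc]; field_simp
    refine le_of_mul_le_mul_left ?_ hμ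
    have h₅ := mul_le_mul_of_nonneg_left hdesc hμ.le
    have h₆ : μ * (S / (2 * Lγ) * G ^ 2) = α * γ * c / 2 * G ^ 2 := by rw [← h₄]; ring
    have h₇ : α * γ * c * G ^ 2 = μ * α * γ * G ^ 2 - α * (2 * s * γ * Lm * G ^ 2) := by
      rw [hc]; ring
    linarith
  have hS0 : 0 ≤ S := by
    have : 0 < 1 - 2 * s * Lm / μ := by rw [sub_pos, div_lt_one hμ]; exact hεμ
    rw [hS]; positivity
  have hfin := mul_le_mul_of_nonneg_left hPL (show 0 ≤ S / (4 * Lγ * B) by positivity)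
  have e₁ : S / (4 * Lγ * B) * (2 * B * G ^ 2) = S / (2 * Lγ) * G ^ 2 := by field_simp; ring
  have e₂ : S / (4 * Lγ * B) * (μ * (M x - m)) = μ / (4 * Lγ * B) * S * (M x - m) := by ring
  linarith

end SmoothConvex


theorem fedexprox_rel_sgd_Delta
    {d n : ℕ} (hn : 1 ≤ n)
    (f : Fin n → EuclideanSpace ℝ (Fin d) → ℝ)
    (f' : Fin n → EuclideanSpace ℝ (Fin d) → EuclideanSpace ℝ (Fin d))
    (L : Fin n → ℝ) (hLpos : ∀ i, 0 < L i)
    (hdiff : ∀ i x, HasGradientAt (f i) (f' i x) x)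
    (hconv : ∀ i, ConvexOn ℝ Set.univ (f i))
    (hsmooth : ∀ i x y, ‖f' i x - f' i y‖ ≤ L i * ‖x - y‖)
    (Lmax : ℝ) (hLmax : IsGreatest (Set.range L) Lmax)
    (xstar : EuclideanSpace ℝ (Fin d)) (hinterp : ∀ i, f' i xstar = 0)
    (μ : ℝ) (hμ : 0 < μ)
    (hsc : StrongConvexOn Set.univ μ (fun x => (1 / (n : ℝ)) * ∑ i, f i x))
    (γ : ℝ) (hγ : 0 < γ)
    (prox : Fin n → EuclideanSpace ℝ (Fin d) → EuclideanSpace ℝ (Fin d))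
    (hprox : ∀ i x, IsMinOn (fun z => f i z + ‖z - x‖ ^ 2 / (2 * γ)) Set.univ (prox i x))
    (hproxu : ∀ i x q, IsMinOn (fun z => f i z + ‖z - x‖ ^ 2 / (2 * γ)) Set.univ q → q = prox i x)
    (M : EuclideanSpace ℝ (Fin d) → ℝ)
    (hM : ∀ x, M x = (1 / (n : ℝ)) * ∑ i, (f i (prox i x) + ‖prox i x - x‖ ^ 2 / (2 * γ)))
    (M' : EuclideanSpace ℝ (Fin d) → EuclideanSpace ℝ (Fin d))
    (hM' : ∀ x, M' x = (1 / ((n : ℝ) * γ)) • ∑ i, (x - prox i x))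
    (hMdiff : ∀ x, HasGradientAt M (M' x) x)
    (Minf : ℝ) (hMinf : Minf = M xstar) (hMinfLB : ∀ x, Minf ≤ M x)
    (Lγ : ℝ) (hLγ : 0 < Lγ)
    (hMLip : ∀ x y, ‖M' x - M' y‖ ≤ Lγ * ‖x - y‖)
    (α : ℝ)
    (xseq : ℕ → EuclideanSpace ℝ (Fin d))
    (xtil : Fin n → ℕ → EuclideanSpace ℝ (Fin d))
    (hrec : ∀ k : ℕ, xseq (k + 1) = xseq k + α • ((1 / (n : ℝ)) • (∑ i, xtil i k) - xseq k))
    (ε₂ : ℝ) (hε₂ : 0 ≤ ε₂)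
    (happrox : ∀ (i : Fin n) (k : ℕ),
      ‖xtil i k - prox i (xseq k)‖ ^ 2 ≤ ε₂ * ‖xseq k - prox i (xseq k)‖ ^ 2)
    (hε₂lt : ε₂ < μ ^ 2 / (4 * Lmax ^ 2))
    (hα : α = (1 / (γ * Lγ)) * ((μ - 2 * Real.sqrt ε₂ * Lmax) / (μ + 4 * Real.sqrt ε₂ * Lmax + 4 * ε₂ * Lmax)))
    (S : ℝ)
    (hS : S = (μ - 2 * Real.sqrt ε₂ * Lmax) * (1 - 2 * Real.sqrt ε₂ * Lmax / μ) /
      (μ + 4 * Real.sqrt ε₂ * Lmax + 4 * ε₂ * Lmax))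
    : (0 < S ∧ S ≤ 1) ∧
      ∀ K : ℕ,
        ‖xseq K - xstar‖ ^ 2 ≤
          (1 - μ / (4 * Lγ * (1 + γ * Lmax)) * S) ^ K * (Lγ * (1 + γ * Lmax) / μ) * ‖xseq 0 - xstar‖ ^ 2 := by
  have hn0 : (0 : ℝ) < n := by exact_mod_cast hn
  have hLle (i) : L i ≤ Lmax := hLmax.2 ⟨i, rfl⟩
  have hLm : 0 < Lmax := (hLpos ⟨0, hn⟩).trans_le (hLle _)
  have hs := Real.sq_sqrt hε₂
  have hs0 := Real.sqrt_nonneg ε₂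
  have hεμ : 2 * √ε₂ * Lmax < μ := by
    rw [lt_div_iff₀ (by positivity)] at hε₂lt
    refine lt_of_pow_lt_pow_left₀ 2 hμ.le ?_
    rw [mul_pow, mul_pow, hs]
    linarith
  have hc₁ : 0 < 1 - 2 * √ε₂ * Lmax / μ := by rw [sub_pos, div_lt_one hμ]; exact hεμ
  have hS0 : 0 < S := by
    have : 0 < μ - 2 * √ε₂ * Lmax := by linarith
    rw [hS]; positivity
  have hS1 : S ≤ 1 := by
    have h₁ : 0 ≤ 2 * √ε₂ * Lmax := by positivity
    have h₂ : 0 ≤ 2 * √ε₂ * Lmax / μ := by positivity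
    have h₃ : 0 ≤ 4 * ε₂ * Lmax := by positivity
    rw [hS, div_le_one (by positivity)]
    nlinarith [mul_le_mul_of_nonneg_left (show 1 - 2 * √ε₂ * Lmax / μ ≤ 1 by linarith)
      (show 0 ≤ μ - 2 * √ε₂ * Lmax by linarith)]
  refine ⟨⟨hS0, hS1⟩, fun K => ?_⟩
  rcases subsingleton_or_nontrivial (EuclideanSpace ℝ (Fin d)) with hE | hE
  · simp [Subsingleton.elim (xseq K) xstar, Subsingleton.elim (xseq 0) xstar]
  have hfmin (i) (y) : f i xstar ≤ f i y :=
    (hconv i).le_of_hasGradientAt_zero (hinterp i ▸ hdiff i xstar) y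
  have hp (i) (x) : f' i (prox i x) = (1 / γ) • (x - prox i x) :=
    gradient_eq_of_isMinOn_prox (hdiff i _) (hprox i x)
  have hpstar (i) : prox i xstar = xstar := by
    refine (hproxu i xstar xstar fun z _ => ?_).symm
    have h₁ : 0 ≤ ‖z - xstar‖ ^ 2 / (2 * γ) := by positivity
    simpa using (hfmin i z).trans (le_add_of_nonneg_right h₁)
  have hgap (x) : M x - Minf = (1 / (n : ℝ)) *
      ∑ i, (f i (prox i x) + ‖prox i x - x‖ ^ 2 / (2 * γ) - f i xstar) := by
    rw [hMinf, hM, hM, ← mul_sub, ← Finset.sum_sub_distrib]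
    simp [hpstar]
  have hprop (i) (x) := sub_le_mul_moreau_sub (hdiff i) (hsmooth i) (hLpos i) hγ (hfmin i) (hp i x)
  have hgap0 (i) (x) : 0 ≤ f i (prox i x) + ‖prox i x - x‖ ^ 2 / (2 * γ) - f i xstar := by
    have : 0 ≤ ‖prox i x - x‖ ^ 2 / (2 * γ) := by positivity
    linarith [hfmin i (prox i x)]
  set B := 1 + γ * Lmax with hB
  have hB0 : 0 < B := by positivity
  have hgrowth (x) : μ / 2 * ‖x - xstar‖ ^ 2 ≤ (1 / (n : ℝ)) * ∑ i, (f i x - f i xstar) := by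
    have := hsc.quadratic_growth (x := xstar)
      (fun y => by gcongr with i; exact hfmin i y) x
    rwa [← mul_sub, ← Finset.sum_sub_distrib] at this
  have hQ (x) : μ / 2 * ‖x - xstar‖ ^ 2 ≤ B * (M x - Minf) := by
    refine (hgrowth x).trans ?_
    rw [hgap, mul_left_comm]
    refine mul_le_mul_of_nonneg_left ?_ (by positivity)
    rw [Finset.mul_sum]
    refine Finset.sum_le_sum fun i _ => (hprop i x).1.trans ?_
    refine mul_le_mul_of_nonneg_right ?_ (hgap0 i x)
    linarith [mul_le_mul_of_nonneg_left (hLle i) hγ.le]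
  have hμL : μ ≤ Lmax := by
    obtain ⟨x, hx⟩ := exists_ne xstar
    have hx0 : 0 < ‖x - xstar‖ ^ 2 := by
      have := norm_pos_iff.2 (sub_ne_zero.2 hx)
      positivity
    have h₁ : (1 / (n : ℝ)) * ∑ i, (f i x - f i xstar) ≤
        (1 / (n : ℝ)) * ∑ _i : Fin n, Lmax / 2 * ‖x - xstar‖ ^ 2 := by
      gcongr with i
      have h₂ := le_add_inner_add_sq_of_lipschitz_gradient (hdiff i) (hsmooth i) xstar (x - xstar)
      rw [hinterp, inner_zero_left, add_sub_cancel] at h₂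
      have h₃ : L i / 2 * ‖x - xstar‖ ^ 2 ≤ Lmax / 2 * ‖x - xstar‖ ^ 2 := by
        have := hLle i
        gcongr
      linarith
    rw [Finset.sum_const, Finset.card_univ, Fintype.card_fin, nsmul_eq_mul, ← mul_assoc,
      one_div_mul_cancel hn0.ne', one_mul] at h₁
    have h₂ := le_of_mul_le_mul_right ((hgrowth x).trans h₁) hx0
    linarith
  have hupper (x) : M x - Minf ≤ Lγ / 2 * ‖x - xstar‖ ^ 2 := by
    have h := le_add_inner_add_sq_of_lipschitz_gradient hMdiff hMLip xstar (x - xstar)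
    have h₀ : M' xstar = 0 := by rw [hM']; simp [hpstar]
    rw [h₀, inner_zero_left, add_sub_cancel, ← hMinf] at h
    linarith
  have hμB : μ ≤ Lγ * B := by
    obtain ⟨x, hx⟩ := exists_ne xstar
    have hx0 : 0 < ‖x - xstar‖ ^ 2 := by
      have := norm_pos_iff.2 (sub_ne_zero.2 hx)
      positivity
    have h₁ := mul_le_mul_of_nonneg_left (hupper x) hB0.le
    refine le_of_mul_le_mul_right ?_ hx0
    linarith [hQ x]
  have hinner (x) : M x - Minf ≤ inner ℝ (M' x) (x - xstar) := by
    have h₁ : ∑ i, γ * (f i (prox i x) + ‖prox i x - x‖ ^ 2 / (2 * γ) - f i xstar) ≤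
        ∑ i, inner ℝ (x - prox i x) (x - xstar) :=
      Finset.sum_le_sum fun i _ => mul_moreau_sub_le_inner (hconv i) (hdiff i _) hγ (hp i x)
    rw [hM', real_inner_smul_left, sum_inner, hgap]
    refine le_trans (le_of_eq ?_) (mul_le_mul_of_nonneg_left h₁ (by positivity))
    rw [← Finset.mul_sum, ← mul_assoc, show 1 / (n * γ) * γ = 1 / (n : ℝ) by field_simp]
  have hstep (k) : M (xseq (k + 1)) - Minf ≤
      (1 - μ / (4 * Lγ * B) * S) * (M (xseq k) - Minf) := by
    set x := xseq k with hx
    set e := (1 / (n : ℝ)) • ∑ i, (xtil i k - prox i x) with he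
    have hxk : xseq (k + 1) = x - α • (γ • M' x - e) := by
      have h₁ : γ • M' x = x - (1 / (n : ℝ)) • ∑ i, prox i x := by
        rw [hM', smul_smul, Finset.sum_sub_distrib, Finset.sum_const, Finset.card_univ,
          Fintype.card_fin, ← Nat.cast_smul_eq_nsmul ℝ, smul_sub, smul_smul,
          show γ * (1 / (n * γ)) * n = 1 by field_simp, one_smul,
          show γ * (1 / (n * γ)) = 1 / (n : ℝ) by field_simp]
      rw [hrec, ← hx, h₁, he, Finset.sum_sub_distrib]
      simp only [smul_sub]
      abel
    have hebound : B * ‖e‖ ^ 2 ≤ 2 * ε₂ * γ ^ 2 * Lmax * (M x - Minf) := by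
      calc B * ‖e‖ ^ 2
          ≤ B * ((1 / (n : ℝ)) * ∑ i, ‖xtil i k - prox i x‖ ^ 2) := by
            gcongr; exact sq_norm_mean_le hn _
        _ = (1 / (n : ℝ)) * ∑ i, B * ‖xtil i k - prox i x‖ ^ 2 := by
            rw [mul_left_comm, Finset.mul_sum]
        _ ≤ (1 / (n : ℝ)) * ∑ i, 2 * ε₂ * γ ^ 2 * Lmax *
              (f i (prox i x) + ‖prox i x - x‖ ^ 2 / (2 * γ) - f i xstar) := by
            refine mul_le_mul_of_nonneg_left (Finset.sum_le_sum fun i _ => ?_) (by positivity)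
            have h₁ := happrox i k
            rw [← hx, norm_sub_rev x] at h₁
            have h₂ := (hprop i x).2
            set r := ‖prox i x - x‖ ^ 2 with hr
            have hr0 : 0 ≤ r := by positivity
            set g := f i (prox i x) + r / (2 * γ) - f i xstar
            have h₃ : 0 ≤ 2 * γ ^ 2 * g - γ * r := by
              refine nonneg_of_mul_nonneg_right ?_ (hLpos i)
              linarith
            have h₄ := mul_le_mul_of_nonneg_right (hLle i) h₃
            have h₅ : B * r ≤ 2 * γ ^ 2 * Lmax * g := by rw [hB]; linarith
            have h₆ := mul_le_mul_of_nonneg_left h₁ hB0.le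
            have h₇ := mul_le_mul_of_nonneg_left h₅ hε₂
            linarith
        _ = _ := by rw [hgap, ← Finset.mul_sum]; ring
    rw [hxk]
    exact biased_gradient_step hMdiff hMLip hLγ hμ hμL hB0 hγ hε₂ hεμ hα hS
      (polyak_lojasiewicz_of_quadratic_growth (sub_nonneg.2 (hMinfLB x)) hμ hB0 (hinner x) (hQ x))
      hebound
  have hq : 0 ≤ 1 - μ / (4 * Lγ * B) * S := by
    have h₁ : μ / (4 * Lγ * B) ≤ 1 := by
      rw [div_le_one (by positivity)]; nlinarith
    have h₂ : 0 ≤ μ / (4 * Lγ * B) := by positivity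
    nlinarith
  have hiter : M (xseq K) - Minf ≤ (1 - μ / (4 * Lγ * B) * S) ^ K * (M (xseq 0) - Minf) := by
    induction K with
    | zero => simp
    | succ k ih =>
      refine (hstep k).trans ?_
      rw [pow_succ', mul_assoc (1 - μ / (4 * Lγ * B) * S)]
      exact mul_le_mul_of_nonneg_left ih hq
  set q := (1 - μ / (4 * Lγ * B) * S) ^ K
  have hqK : 0 ≤ q := pow_nonneg hq K
  have h₁ := mul_le_mul_of_nonneg_left
    (hiter.trans (mul_le_mul_of_nonneg_left (hupper (xseq 0)) hqK)) hB0.le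
  have h₂ := (hQ (xseq K)).trans h₁
  refine le_of_mul_le_mul_left ?_ (half_pos hμ)
  refine h₂.trans (le_of_eq ?_)
  field_simp
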